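/- arXiv:2404.13072 — 6 statements merged into one kernel-verified Lean document; each statement's English description precedes it below -/
import Mathlib

section
/- Let X be a real reflexive Banach space, C ⊆ X a nonempty, non-singleton, closed convex set, and φ : X → ℝ a locally Lipschitz functional satisfying the (CPS)_C condition and such that, for every x ∈ C, m_C(x) = 0 implies m(x) = 0. Let A ⊆ C be a closed set on which φ is bounded and which contains no critical point of φ (i.e. 0 ∉ ∂φ(x) for all x ∈ A). Then there exists γ > 0 such that (1+‖x‖)·m_C(x) ≥ γ for all x ∈ A. (Claims (2.6)–(2.8) in the proof of Lemma 2.3) -/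
open Filter Topology Set

noncomputable section

variable {X : Type*} [NormedAddCommGroup X] [NormedSpace ℝ X]

/-- Clarke generalized directional derivative of a locally Lipschitz functional. -/
def clarkeDeriv (φ : X → ℝ) (x h : X) : ℝ :=
  Filter.limsup (fun p : X × ℝ => (φ (p.1 + p.2 • h) - φ p.1) / p.2)
    ((𝓝 x) ×ˢ (𝓝[>] (0 : ℝ)))

/-- Clarke subdifferential. -/
def clarkeSubdiff (φ : X → ℝ) (x : X) : Set (X →L[ℝ] ℝ) :=
  {xs | ∀ h : X, xs h ≤ clarkeDeriv φ x h}

/-- `m(x) = inf {‖x*‖ : x* ∈ ∂φ(x)}`. -/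
def mSlope (φ : X → ℝ) (x : X) : ℝ :=
  sInf {r | ∃ xs ∈ clarkeSubdiff φ x, r = ‖xs‖}

/-- `m_C(x)`. -/
def mCSlope (φ : X → ℝ) (C : Set X) (x : X) : ℝ :=
  sInf {r | ∃ xs ∈ clarkeSubdiff φ x,
    r = sSup {s | ∃ y ∈ C, ‖x - y‖ < 1 ∧ s = xs (x - y)}}

/-- the nonsmooth (CPS)-condition on the whole space. -/
def CPS (φ : X → ℝ) : Prop :=
  ∀ x : ℕ → X, (∃ M : ℝ, ∀ n, |φ (x n)| ≤ M) →
    Tendsto (fun n => (1 + ‖x n‖) * mSlope φ (x n)) atTop (𝓝 0) →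
    ∃ z : X, ∃ s : ℕ → ℕ, StrictMono s ∧ Tendsto (fun n => x (s n)) atTop (𝓝 z)

/-- the nonsmooth (CPS)_D-condition on a set D. -/
def CPSOn (φ : X → ℝ) (D : Set X) : Prop :=
  ∀ x : ℕ → X, (∀ n, x n ∈ D) → (∃ M : ℝ, ∀ n, |φ (x n)| ≤ M) →
    Tendsto (fun n => (1 + ‖x n‖) * mCSlope φ D (x n)) atTop (𝓝 0) →
    ∃ z : X, ∃ s : ℕ → ℕ, StrictMono s ∧ Tendsto (fun n => x (s n)) atTop (𝓝 z)

/-- the (PS)-condition. -/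
def PSCond (φ : X → ℝ) : Prop :=
  ∀ x : ℕ → X, (∃ M : ℝ, ∀ n, |φ (x n)| ≤ M) →
    Tendsto (fun n => mSlope φ (x n)) atTop (𝓝 0) →
    ∃ z : X, ∃ s : ℕ → ℕ, StrictMono s ∧ Tendsto (fun n => x (s n)) atTop (𝓝 z)

/-- duality map F(x*). -/
def dualityMap (xs : X →L[ℝ] ℝ) : Set X :=
  {x | xs x = ‖xs‖ ^ 2 ∧ ‖x‖ ^ 2 = ‖xs‖ ^ 2}

/-- `∇φ(x) = F(∂φ(x))`. -/
def clarkeGrad (φ : X → ℝ) (x : X) : Set X :=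
  ⋃ xs ∈ clarkeSubdiff φ x, dualityMap xs

/-- normal cone to a convex set. -/
def normalCone (C : Set X) (x : X) : Set (X →L[ℝ] ℝ) :=
  {xs | ∀ z ∈ C, xs (z - x) ≤ 0}

/-- `∂φ` outwardly directed on `∂C`. -/
def OutwardlyDirected (φ : X → ℝ) (C : Set X) : Prop :=
  ∀ x ∈ frontier C, ∀ xs ∈ clarkeSubdiff φ x, -xs ∈ normalCone C x → xs = 0

/-- Schauder invariance condition `(I - ∇φ)(C) ⊆ C`. -/
def SchauderInv (φ : X → ℝ) (C : Set X) : Prop :=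
  ∀ x ∈ C, ∀ w ∈ clarkeGrad φ x, x - w ∈ C

/-- Reflexivity of a normed space. -/
def ReflexiveSpace (X : Type*) [NormedAddCommGroup X] [NormedSpace ℝ X] : Prop :=
  Function.Surjective (NormedSpace.inclusionInDoubleDual ℝ X)

/-- Locally Lipschitz on a set. -/
def LocLipOn {α β : Type*} [PseudoMetricSpace α] [PseudoMetricSpace β]
    (f : α → β) (s : Set α) : Prop :=
  ∀ x ∈ s, ∃ K : NNReal, ∃ t ∈ 𝓝[s] x, LipschitzOnWith K f t


lemma LocallyLipschitz.eventually_abs_quotient_le {φ : X → ℝ} (hφ : LocallyLipschitz φ) (x : X) :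
    ∃ K : ℝ, 0 ≤ K ∧ ∀ᶠ y in 𝓝 x, ∀ h : X, ∀ᶠ p in 𝓝 y ×ˢ 𝓝[>] (0 : ℝ),
      |(φ (p.1 + p.2 • h) - φ p.1) / p.2| ≤ K * ‖h‖ := by
  obtain ⟨K, t, ht, hK⟩ := hφ x
  refine ⟨K, K.2, ?_⟩
  filter_upwards [eventually_mem_nhds_iff.2 ht] with y hy h
  have h₁ : Tendsto (fun p : X × ℝ => p.1) (𝓝 y ×ˢ 𝓝[>] (0 : ℝ)) (𝓝 y) := tendsto_fst
  have h₂ : Tendsto (fun p : X × ℝ => p.1 + p.2 • h) (𝓝 y ×ˢ 𝓝[>] (0 : ℝ)) (𝓝 y) := by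
    have h₃ : Tendsto (fun p : X × ℝ => p.2) (𝓝 y ×ˢ 𝓝[>] (0 : ℝ)) (𝓝 0) :=
      tendsto_snd.mono_right nhdsWithin_le_nhds
    simpa using h₁.add (h₃.smul_const h)
  have h₄ : ∀ᶠ p in 𝓝 y ×ˢ 𝓝[>] (0 : ℝ), 0 < p.2 :=
    tendsto_snd.eventually self_mem_nhdsWithin
  filter_upwards [h₁ hy, h₂ hy, h₄] with p hp₁ hp₂ hp
  have := hK.dist_le_mul _ hp₂ _ hp₁
  rw [Real.dist_eq, dist_eq_norm, add_sub_cancel_left, norm_smul, Real.norm_of_nonneg hp.le] at this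
  rw [abs_div, abs_of_pos hp, div_le_iff₀ hp]
  linarith

lemma clarkeDeriv_le_of_eventually_le {φ : X → ℝ} (hφ : LocallyLipschitz φ) {x h : X} {c : ℝ}
    (hc : ∀ᶠ p in 𝓝 x ×ˢ 𝓝[>] (0 : ℝ), (φ (p.1 + p.2 • h) - φ p.1) / p.2 ≤ c) :
    clarkeDeriv φ x h ≤ c := by
  obtain ⟨K, -, hK⟩ := hφ.eventually_abs_quotient_le x
  have hb : (𝓝 x ×ˢ 𝓝[>] (0 : ℝ)).IsBoundedUnder (· ≥ ·)
      fun p : X × ℝ => (φ (p.1 + p.2 • h) - φ p.1) / p.2 :=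
    isBoundedUnder_of_eventually_ge <| (hK.self_of_nhds h).mono fun _ hp => (abs_le.1 hp).1
  exact limsup_le_of_le hb.isCoboundedUnder_le hc

lemma eventually_lt_of_clarkeDeriv_lt {φ : X → ℝ} (hφ : LocallyLipschitz φ) {x h : X} {c : ℝ}
    (hc : clarkeDeriv φ x h < c) :
    ∀ᶠ p in 𝓝 x ×ˢ 𝓝[>] (0 : ℝ), (φ (p.1 + p.2 • h) - φ p.1) / p.2 < c := by
  obtain ⟨K, -, hK⟩ := hφ.eventually_abs_quotient_le x
  exact eventually_lt_of_limsup_lt hc <| isBoundedUnder_of_eventually_le <|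
    (hK.self_of_nhds h).mono fun _ hp => (abs_le.1 hp).2

lemma eventually_clarkeDeriv_le_mul_norm {φ : X → ℝ} (hφ : LocallyLipschitz φ) (x : X) :
    ∃ K : ℝ, 0 ≤ K ∧ ∀ᶠ y in 𝓝 x, ∀ h : X, clarkeDeriv φ y h ≤ K * ‖h‖ := by
  obtain ⟨K, hK₀, hK⟩ := hφ.eventually_abs_quotient_le x
  refine ⟨K, hK₀, hK.mono fun y hy h => clarkeDeriv_le_of_eventually_le hφ ?_⟩
  exact (hy h).mono fun _ hp => (abs_le.1 hp).2

lemma upperSemicontinuous_clarkeDeriv {φ : X → ℝ} (hφ : LocallyLipschitz φ) (h : X) :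
    UpperSemicontinuous fun x => clarkeDeriv φ x h := by
  intro x c hc
  obtain ⟨d, hd, hdc⟩ := exists_between hc
  obtain ⟨P, hP, Q, hQ, hPQ⟩ := eventually_prod_iff.1 (eventually_lt_of_clarkeDeriv_lt hφ hd)
  filter_upwards [eventually_eventually_nhds.2 hP] with y hy
  refine (clarkeDeriv_le_of_eventually_le hφ ?_).trans_lt hdc
  exact eventually_prod_iff.2 ⟨P, hy, Q, hQ, fun hp _ hq => (hPQ hp hq).le⟩

lemma clarkeDeriv_add_le {φ : X → ℝ} (hφ : LocallyLipschitz φ) (x h k : X) :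
    clarkeDeriv φ x (h + k) ≤ clarkeDeriv φ x h + clarkeDeriv φ x k := by
  refine le_of_forall_pos_le_add fun ε hε => clarkeDeriv_le_of_eventually_le hφ ?_
  have e₁ := eventually_lt_of_clarkeDeriv_lt hφ (lt_add_of_pos_right (clarkeDeriv φ x h) (half_pos hε))
  have e₂ := eventually_lt_of_clarkeDeriv_lt hφ (lt_add_of_pos_right (clarkeDeriv φ x k) (half_pos hε))
  have ht : Tendsto (fun p : X × ℝ => (p.1 + p.2 • k, p.2)) (𝓝 x ×ˢ 𝓝[>] (0 : ℝ))
      (𝓝 x ×ˢ 𝓝[>] (0 : ℝ)) := by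
    refine Tendsto.prodMk ?_ tendsto_snd
    have h₃ : Tendsto (fun p : X × ℝ => p.2) (𝓝 x ×ˢ 𝓝[>] (0 : ℝ)) (𝓝 0) :=
      tendsto_snd.mono_right nhdsWithin_le_nhds
    simpa using (tendsto_fst (f := 𝓝 x)).add (h₃.smul_const k)
  filter_upwards [ht.eventually e₁, e₂] with p hp₁ hp₂
  have hsplit : (φ (p.1 + p.2 • (h + k)) - φ p.1) / p.2 =
      (φ (p.1 + p.2 • k + p.2 • h) - φ (p.1 + p.2 • k)) / p.2 +
        (φ (p.1 + p.2 • k) - φ p.1) / p.2 := by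
    rw [smul_add, add_comm (p.2 • h), ← add_assoc]
    ring
  linarith

lemma clarkeDeriv_smul_le {φ : X → ℝ} (hφ : LocallyLipschitz φ) (x h : X) {c : ℝ} (hc : 0 < c) :
    clarkeDeriv φ x (c • h) ≤ c * clarkeDeriv φ x h := by
  refine le_of_forall_pos_le_add fun ε hε => clarkeDeriv_le_of_eventually_le hφ ?_
  have e := eventually_lt_of_clarkeDeriv_lt hφ
    (lt_add_of_pos_right (clarkeDeriv φ x h) (div_pos hε hc))
  have ht : Tendsto (fun p : X × ℝ => (p.1, p.2 * c)) (𝓝 x ×ˢ 𝓝[>] (0 : ℝ))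
      (𝓝 x ×ˢ 𝓝[>] (0 : ℝ)) := by
    refine Tendsto.prodMk tendsto_fst (tendsto_nhdsWithin_iff.2 ⟨?_, ?_⟩)
    · have h₃ : Tendsto (fun p : X × ℝ => p.2) (𝓝 x ×ˢ 𝓝[>] (0 : ℝ)) (𝓝 0) :=
        tendsto_snd.mono_right nhdsWithin_le_nhds
      simpa using h₃.mul_const c
    · exact (tendsto_snd.eventually (self_mem_nhdsWithin (s := Ioi (0 : ℝ)))).mono
        fun p hp => mul_pos hp hc
  have h₄ : ∀ᶠ p in 𝓝 x ×ˢ 𝓝[>] (0 : ℝ), 0 < p.2 :=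
    tendsto_snd.eventually self_mem_nhdsWithin
  filter_upwards [ht.eventually e, h₄] with p hp hp₂
  have hscale : (φ (p.1 + p.2 • c • h) - φ p.1) / p.2 =
      c * ((φ (p.1 + (p.2 * c) • h) - φ p.1) / (p.2 * c)) := by
    rw [smul_smul]
    field_simp
  have : c * (clarkeDeriv φ x h + ε / c) = c * clarkeDeriv φ x h + ε := by field_simp
  rw [hscale, ← this]
  exact mul_le_mul_of_nonneg_left hp.le hc.le

lemma clarkeDeriv_smul {φ : X → ℝ} (hφ : LocallyLipschitz φ) (x h : X) {c : ℝ} (hc : 0 < c) :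
    clarkeDeriv φ x (c • h) = c * clarkeDeriv φ x h := by
  refine (clarkeDeriv_smul_le hφ x h hc).antisymm ?_
  have := clarkeDeriv_smul_le hφ x (c • h) (inv_pos.2 hc)
  rwa [inv_smul_smul₀ hc.ne', ← div_eq_inv_mul, le_div_iff₀ hc, mul_comm] at this

lemma abs_apply_le_of_forall_le {f : X →ₗ[ℝ] ℝ} {K : ℝ} (hf : ∀ h, f h ≤ K * ‖h‖) (h : X) :
    |f h| ≤ K * ‖h‖ := by
  have := hf (-h)
  rw [map_neg, norm_neg] at this
  exact abs_le.2 ⟨by linarith, hf h⟩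

lemma clarkeSubdiff_nonempty {φ : X → ℝ} (hφ : LocallyLipschitz φ) (x : X) :
    (clarkeSubdiff φ x).Nonempty := by
  obtain ⟨K, -, hK⟩ := eventually_clarkeDeriv_le_mul_norm hφ x
  have h₀ : clarkeDeriv φ x 0 = 0 := by
    have := clarkeDeriv_smul hφ x 0 two_pos
    rw [smul_zero] at this
    linarith
  obtain ⟨g, -, hg⟩ := exists_extension_of_le_sublinear (⊥ : X →ₗ.[ℝ] ℝ) (clarkeDeriv φ x)
    (fun c hc h => clarkeDeriv_smul hφ x h hc) (clarkeDeriv_add_le hφ x) fun y => by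
      have hy : y = 0 := Subtype.ext ((Submodule.mem_bot ℝ).1 y.2)
      rw [hy, LinearPMap.map_zero, ZeroMemClass.coe_zero, h₀]
  exact ⟨g.mkContinuous K fun h =>
    abs_apply_le_of_forall_le (fun k => (hg k).trans (hK.self_of_nhds k)) h, hg⟩

lemma exists_mem_clarkeSubdiff_tendsto {φ : X → ℝ} (hφ : LocallyLipschitz φ) {ι : Type*}
    (U : Ultrafilter ι) {x : ι → X} {z : X} (hx : Tendsto x U (𝓝 z)) {ξ : ι → X →L[ℝ] ℝ}
    (hξ : ∀ i, ξ i ∈ clarkeSubdiff φ (x i)) :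
    ∃ η ∈ clarkeSubdiff φ z, ∀ y, Tendsto (fun i => ξ i (x i - y)) U (𝓝 (η (z - y))) := by
  obtain ⟨K, hK₀, hK⟩ := eventually_clarkeDeriv_le_mul_norm hφ z
  have hbound : ∀ᶠ i in (U : Filter ι), ‖ξ i‖ ≤ K :=
    (hx.eventually hK).mono fun i hi => (ξ i).opNorm_le_bound hK₀ <|
      abs_apply_le_of_forall_le (f := (ξ i : X →ₗ[ℝ] ℝ)) fun k => (hξ i k).trans (hi k)
  obtain ⟨η, -, hη⟩ := (WeakDual.isCompact_closedBall (𝕜 := ℝ) (0 : StrongDual ℝ X) K)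
    |>.ultrafilter_le_nhds' (U.map fun i => StrongDual.toWeakDual (ξ i))
      (hbound.mono fun i hi => by simpa using hi)
  have hlim : ∀ h, Tendsto (fun i => ξ i h) U (𝓝 (WeakDual.toStrongDual η h)) :=
    tendsto_iff_forall_eval_tendsto_topDualPairing.1 hη
  refine ⟨WeakDual.toStrongDual η, fun h => ?_, fun y => ?_⟩
  · refine le_of_forall_gt_imp_ge_of_dense fun c hc => le_of_tendsto (hlim h) ?_
    exact (hx.eventually (upperSemicontinuous_clarkeDeriv hφ h z c hc)).mono
      fun i hi => (hξ i h).trans hi.le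
  · have hsmall : Tendsto (fun i => ξ i (x i - z)) U (𝓝 0) := by
      refine squeeze_zero_norm' (a := fun i => K * ‖x i - z‖) ?_ ?_
      · exact hbound.mono fun i hi => (ξ i).le_of_opNorm_le hi _
      · simpa using (tendsto_iff_norm_sub_tendsto_zero.1 hx).const_mul K
    simpa [← map_add] using hsmall.add (hlim (z - y))

lemma bddAbove_apply_sub (C : Set X) (x : X) (ξ : X →L[ℝ] ℝ) :
    BddAbove {s | ∃ y ∈ C, ‖x - y‖ < 1 ∧ s = ξ (x - y)} := by
  refine ⟨‖ξ‖, ?_⟩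
  rintro _ ⟨y, -, hy, rfl⟩
  exact (le_abs_self _).trans ((ξ.le_opNorm _).trans (mul_le_of_le_one_right (norm_nonneg _) hy.le))

lemma sSup_apply_sub_nonneg {C : Set X} {x : X} (hx : x ∈ C) (ξ : X →L[ℝ] ℝ) :
    0 ≤ sSup {s | ∃ y ∈ C, ‖x - y‖ < 1 ∧ s = ξ (x - y)} :=
  le_csSup (bddAbove_apply_sub C x ξ) ⟨x, hx, by simp, by simp⟩

lemma mCSlope_nonneg (φ : X → ℝ) {C : Set X} {x : X} (hx : x ∈ C) : 0 ≤ mCSlope φ C x := by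
  refine Real.sInf_nonneg ?_
  rintro _ ⟨ξ, -, rfl⟩
  exact sSup_apply_sub_nonneg hx ξ

lemma exists_mem_clarkeSubdiff_apply_sub_lt {φ : X → ℝ} (hφ : LocallyLipschitz φ) {C : Set X}
    {x : X} {c : ℝ} (hc : mCSlope φ C x < c) :
    ∃ ξ ∈ clarkeSubdiff φ x, ∀ y ∈ C, ‖x - y‖ < 1 → ξ (x - y) < c := by
  obtain ⟨ξ₀, hξ₀⟩ := clarkeSubdiff_nonempty hφ x
  obtain ⟨_, ⟨ξ, hξ, rfl⟩, hlt⟩ := exists_lt_of_csInf_lt (s := {r | ∃ ξ ∈ clarkeSubdiff φ x,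
    r = sSup {s | ∃ y ∈ C, ‖x - y‖ < 1 ∧ s = ξ (x - y)}}) ⟨_, ξ₀, hξ₀, rfl⟩ hc
  exact ⟨ξ, hξ, fun y hy hxy =>
    (le_csSup (bddAbove_apply_sub C x ξ) ⟨y, hy, hxy, rfl⟩).trans_lt hlt⟩

lemma mCSlope_le_of_forall_apply_sub_le {φ : X → ℝ} {C : Set X} {x : X} (hx : x ∈ C)
    {ξ : X →L[ℝ] ℝ} (hξ : ξ ∈ clarkeSubdiff φ x) {c : ℝ}
    (hc : ∀ y ∈ C, ‖x - y‖ < 1 → ξ (x - y) ≤ c) : mCSlope φ C x ≤ c := by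
  have hbdd : BddBelow {r | ∃ ζ ∈ clarkeSubdiff φ x,
      r = sSup {s | ∃ y ∈ C, ‖x - y‖ < 1 ∧ s = ζ (x - y)}} := by
    refine ⟨0, ?_⟩
    rintro _ ⟨ζ, -, rfl⟩
    exact sSup_apply_sub_nonneg hx ζ
  have hne : {s | ∃ y ∈ C, ‖x - y‖ < 1 ∧ s = ξ (x - y)}.Nonempty := ⟨_, x, hx, by simp, rfl⟩
  refine (csInf_le hbdd ⟨ξ, hξ, rfl⟩).trans (csSup_le hne ?_)
  rintro _ ⟨y, hy, hxy, rfl⟩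
  exact hc y hy hxy

lemma mCSlope_eq_zero_of_tendsto {φ : X → ℝ} (hφ : LocallyLipschitz φ) {C : Set X} {x : ℕ → X}
    {z : X} (hz : z ∈ C) (hx : Tendsto x atTop (𝓝 z))
    (hm : Tendsto (fun n => mCSlope φ C (x n)) atTop (𝓝 0)) : mCSlope φ C z = 0 := by
  have hex : ∀ n : ℕ, ∃ ξ ∈ clarkeSubdiff φ (x n), ∀ y ∈ C, ‖x n - y‖ < 1 →
      ξ (x n - y) < mCSlope φ C (x n) + 1 / ((n : ℝ) + 1) := fun n =>
    exists_mem_clarkeSubdiff_apply_sub_lt hφ (lt_add_of_pos_right _ Nat.one_div_pos_of_nat)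
  choose ξ hξ hlt using hex
  have hU : (hyperfilter ℕ : Filter ℕ) ≤ atTop := Nat.hyperfilter_le_atTop
  obtain ⟨η, hη, hlim⟩ := exists_mem_clarkeSubdiff_tendsto hφ (hyperfilter ℕ) (hx.mono_left hU) hξ
  refine le_antisymm ?_ (mCSlope_nonneg φ hz)
  refine mCSlope_le_of_forall_apply_sub_le hz hη fun y hy hzy => ?_
  have hε := (hm.add (tendsto_one_div_add_atTop_nhds_zero_nat (𝕜 := ℝ))).mono_left hU
  rw [add_zero] at hε
  refine le_of_tendsto_of_tendsto (hlim y) hε ?_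
  have hnorm : Tendsto (fun n => ‖x n - y‖) atTop (𝓝 ‖z - y‖) := (hx.sub_const y).norm
  exact ((hnorm.eventually_lt_const hzy).filter_mono hU).mono fun n hn => (hlt n y hy hn).le

lemma zero_mem_clarkeSubdiff_of_mSlope_eq_zero {φ : X → ℝ} (hφ : LocallyLipschitz φ) {x : X}
    (hx : mSlope φ x = 0) : (0 : X →L[ℝ] ℝ) ∈ clarkeSubdiff φ x := by
  obtain ⟨ξ₀, hξ₀⟩ := clarkeSubdiff_nonempty hφ x
  intro h
  refine le_of_forall_pos_le_add fun ε hε => ?_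
  have hδ : 0 < ε / (‖h‖ + 1) := by positivity
  obtain ⟨_, ⟨ξ, hξ, rfl⟩, hlt⟩ := exists_lt_of_csInf_lt
    (s := {r | ∃ ξ ∈ clarkeSubdiff φ x, r = ‖ξ‖}) ⟨_, ξ₀, hξ₀, rfl⟩ (hx.trans_lt hδ)
  have h₁ : -ξ h ≤ ‖ξ‖ * ‖h‖ := (neg_le_abs _).trans (ξ.le_opNorm h)
  have h₂ : ‖ξ‖ * (‖h‖ + 1) < ε := (lt_div_iff₀ (by positivity)).1 hlt
  have h₃ := hξ h
  have h₄ := norm_nonneg ξ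
  rw [zero_apply]
  linarith

/-- Claims (2.6)–(2.8): a uniform positive lower bound for `(1+‖x‖)·m_C(x)` on a closed
critical-point-free set `A ⊆ C` on which `φ` is bounded. -/
theorem lemma_2_3_claims
    {X : Type*} [NormedAddCommGroup X] [NormedSpace ℝ X] [CompleteSpace X]
    (hrefl : ReflexiveSpace X)
    (C : Set X) (hCnt : C.Nontrivial) (hCcl : IsClosed C) (hCconv : Convex ℝ C)
    (φ : X → ℝ) (hφ : LocallyLipschitz φ)
    (hCPS : CPSOn φ C)
    (hm : ∀ x ∈ C, mCSlope φ C x = 0 → mSlope φ x = 0)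
    (A : Set X) (hAC : A ⊆ C) (hAcl : IsClosed A)
    (hbdd : ∃ M : ℝ, ∀ x ∈ A, |φ x| ≤ M)
    (hnocrit : ∀ x ∈ A, (0 : X →L[ℝ] ℝ) ∉ clarkeSubdiff φ x) :
    ∃ γ > (0 : ℝ), ∀ x ∈ A, γ ≤ (1 + ‖x‖) * mCSlope φ C x := by
  by_contra! hcon
  have hex : ∀ n : ℕ, ∃ x ∈ A, (1 + ‖x‖) * mCSlope φ C x < 1 / ((n : ℝ) + 1) :=
    fun n => hcon _ Nat.one_div_pos_of_nat
  choose x hxA hx using hex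
  have hm₀ : ∀ n, 0 ≤ mCSlope φ C (x n) := fun n => mCSlope_nonneg φ (hAC (hxA n))
  have hlim : Tendsto (fun n => (1 + ‖x n‖) * mCSlope φ C (x n)) atTop (𝓝 0) :=
    squeeze_zero (fun n => mul_nonneg (by positivity) (hm₀ n)) (fun n => (hx n).le)
      tendsto_one_div_add_atTop_nhds_zero_nat
  obtain ⟨M, hM⟩ := hbdd
  obtain ⟨z, s, hs, hz⟩ := hCPS x (fun n => hAC (hxA n)) ⟨M, fun n => hM _ (hxA n)⟩ hlim
  have hzA : z ∈ A := hAcl.mem_of_tendsto hz (Eventually.of_forall fun n => hxA (s n))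
  have hslope : Tendsto (fun n => mCSlope φ C (x n)) atTop (𝓝 0) :=
    squeeze_zero hm₀
      (fun n => le_mul_of_one_le_left (hm₀ n) (le_add_of_nonneg_right (norm_nonneg _))) hlim
  exact hnocrit z hzA <| zero_mem_clarkeSubdiff_of_mSlope_eq_zero hφ <| hm z (hAC hzA) <|
    mCSlope_eq_zero_of_tendsto hφ (hAC hzA) hz (hslope.comp hs.tendsto_atTop)

end
end

section
/- Let G ⊆ E be a connected invariant set of descending flow and let D be an invariant set of descending flow which is an open subset of G (in the subspace topology of G). Then C_G(D) is an open subset of G. (Lemma 2.5, part 1) -/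
open Filter Topology Set

noncomputable section

variable {E : Type*} [NormedAddCommGroup E] [NormedSpace ℝ E]

/-- `D` is an invariant set of the descending flow `σ` (with maximal existence times `T₁`). -/
def IsFlowInvariant (σ : E → ℝ → E) (T₁ : E → ENNReal) (D : Set E) : Prop :=
  D.Nonempty ∧ ∀ v ∈ D, ∀ t : ℝ, 0 ≤ t → ENNReal.ofReal t < T₁ v → σ v t ∈ D

/-- `C_G(D) = {v₀ ∈ G : v₀ ∈ D, or σ(t',v₀) ∈ D for some t' ∈ (0, T₁(v₀))}`. -/
def flowCG (σ : E → ℝ → E) (T₁ : E → ENNReal) (G D : Set E) : Set E :=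
  {v ∈ G | v ∈ D ∨ ∃ t : ℝ, 0 < t ∧ ENNReal.ofReal t < T₁ v ∧ σ v t ∈ D}

/-- boundary of `S` relative to the subspace topology of `G` (for `S ⊆ G`). -/
def relBoundary (G S : Set E) : Set E :=
  G ∩ closure S ∩ closure (G \ S)

/-- A time-independent locally Lipschitz field satisfies the Picard-Lindelöf assumptions on a
neighbourhood of every point. -/
lemma LocallyLipschitz.exists_isPicardLindelof {F : Type*} [NormedAddCommGroup F] {f : F → F}
    (hf : LocallyLipschitz f) (x₀ : F) :
    ∃ (ε : ℝ) (hε : 0 < ε) (a r L K : NNReal) (_ : 0 < r),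
      IsPicardLindelof (fun _ ↦ f) (tmin := -ε) (tmax := ε)
        ⟨0, by simp [hε.le]⟩ x₀ a r L K := by
  obtain ⟨K, s, hs, hl⟩ := hf x₀
  obtain ⟨b, hb, hbs⟩ := Metric.mem_nhds_iff.mp hs
  set a : NNReal := ⟨b / 2, (half_pos hb).le⟩
  have ha0 : 0 < a := half_pos hb
  have hlip : LipschitzOnWith K f (Metric.closedBall x₀ a) :=
    hl.mono ((Metric.closedBall_subset_ball (half_lt_self hb)).trans hbs)
  set L : NNReal := K * a + ‖f x₀‖₊ + 1 with hL
  have hL0 : 0 < L := by positivity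
  have hbound : ∀ x ∈ Metric.closedBall x₀ (a : ℝ), ‖f x‖ ≤ L := fun x hx ↦ by
    have hx₀ : x₀ ∈ Metric.closedBall x₀ (a : ℝ) := Metric.mem_closedBall_self a.2
    calc
      ‖f x‖ ≤ ‖f x - f x₀‖ + ‖f x₀‖ := norm_le_norm_sub_add _ _
      _ ≤ K * ‖x - x₀‖ + ‖f x₀‖ := by gcongr; exact hlip.norm_sub_le hx hx₀
      _ ≤ K * a + ‖f x₀‖ := by gcongr; exact mem_closedBall_iff_norm.mp hx
      _ ≤ L := by simp [hL]
  refine ⟨a / 2 / L, by positivity, a, a / 2, L, K, by positivity,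
    IsPicardLindelof.of_time_independent hbound hlip ?_⟩
  have : (0 : ℝ) < L := hL0
  simp
  field_simp
  norm_num

/-- `σ` is the family of right-maximal solutions of the equation generated by `f`, with
existence times `T`. -/
structure IsMaximalSemiflow (f : E → E) (σ : E → ℝ → E) (T : E → ENNReal) : Prop where
  map_zero (v : E) : σ v 0 = v
  hasDerivAt (v : E) (t : ℝ) (ht : 0 ≤ t) (htT : ENNReal.ofReal t < T v) :
    HasDerivAt (σ v) (f (σ v t)) t
  maximal (v : E) (T' : ℝ) (τ : ℝ → E) (hτ0 : τ 0 = v)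
    (hτ : ∀ t ∈ Ico (0 : ℝ) T', HasDerivAt τ (f (τ t)) t) :
    ENNReal.ofReal T' ≤ T v ∧ ∀ t ∈ Ico (0 : ℝ) T', τ t = σ v t

namespace IsMaximalSemiflow

variable {f : E → E} {σ : E → ℝ → E} {T : E → ENNReal}

/-- The semigroup property of a maximal semiflow. -/
lemma map_add (hσ : IsMaximalSemiflow f σ T) {v : E} {s h : ℝ} (hs : 0 ≤ s)
    (hsT : ENNReal.ofReal s < T v) (hh : 0 ≤ h) (hhT : ENNReal.ofReal h < T (σ v s)) :
    ENNReal.ofReal (s + h) < T v ∧ σ v (s + h) = σ (σ v s) h := by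
  obtain ⟨h', hhh', hh'T⟩ := ENNReal.lt_iff_exists_nnreal_btwn.mp hhT
  have hlt : h < h' := by
    rw [← ENNReal.ofReal_coe_nnreal] at hhh'
    exact (ENNReal.ofReal_lt_ofReal_iff_of_nonneg hh).mp hhh'
  set τ : ℝ → E := fun u ↦ if u ≤ s then σ v u else σ (σ v s) (u - s) with hτ
  have hτ_le : ∀ u ≤ s, τ u = σ v u := fun u hu ↦ if_pos hu
  have hτ_ge : ∀ u, s ≤ u → τ u = σ (σ v s) (u - s) := fun u hu ↦ by
    rcases hu.eq_or_lt with rfl | hu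
    · simp [hτ, hσ.map_zero]
    · exact if_neg hu.not_ge
  have hleft : ∀ u, 0 ≤ u → u ≤ s → HasDerivAt (σ v) (f (τ u)) u := fun u hu hus ↦ by
    rw [hτ_le u hus]
    exact hσ.hasDerivAt v u hu ((ENNReal.ofReal_le_ofReal hus).trans_lt hsT)
  have hright : ∀ u, s ≤ u → u < s + h' →
      HasDerivAt (fun u ↦ σ (σ v s) (u - s)) (f (τ u)) u := fun u hsu hu ↦ by
    rw [hτ_ge u hsu]
    refine HasDerivAt.comp_sub_const u s (hσ.hasDerivAt _ _ (by linarith) (lt_of_le_of_lt ?_ hh'T))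
    rw [← ENNReal.ofReal_coe_nnreal]
    exact ENNReal.ofReal_le_ofReal (by linarith)
  have hderiv : ∀ u ∈ Ico (0 : ℝ) (s + h'), HasDerivAt τ (f (τ u)) u := by
    rintro u ⟨hu0, hu⟩
    rcases lt_trichotomy u s with hus | rfl | hus
    · refine (hleft u hu0 hus.le).congr_of_eventuallyEq ?_
      filter_upwards [Iio_mem_nhds hus] with x hx using hτ_le x (le_of_lt hx)
    · rw [← hasDerivWithinAt_univ, ← Iic_union_Ici (a := u)]
      exact ((hleft u hu0 le_rfl).hasDerivWithinAt.congr hτ_le (hτ_le u le_rfl)).union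
        ((hright u le_rfl hu).hasDerivWithinAt.congr hτ_ge (hτ_ge u le_rfl))
    · refine (hright u hus.le hu).congr_of_eventuallyEq ?_
      filter_upwards [Ioi_mem_nhds hus] with x hx using hτ_ge x (le_of_lt hx)
  obtain ⟨hT, heq⟩ := hσ.maximal v (s + h') τ ((hτ_le 0 hs).trans (hσ.map_zero v)) hderiv
  refine ⟨lt_of_lt_of_le ?_ hT, ?_⟩
  · exact (ENNReal.ofReal_lt_ofReal_iff_of_nonneg (by linarith)).mpr (by linarith)
  · rw [← heq (s + h) ⟨by linarith, by linarith⟩, hτ_ge _ (by linarith), add_sub_cancel_left]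

/-- Near every point the semiflow exists for a uniform time and depends continuously on the
initial value. -/
lemma exists_ball_continuousOn [CompleteSpace E] (hσ : IsMaximalSemiflow f σ T)
    (hf : LocallyLipschitz f) (p : E) :
    ∃ r > (0 : ℝ), ∃ δ > (0 : ℝ), (∀ x ∈ Metric.ball p r, ENNReal.ofReal δ < T x) ∧
      ∀ t ∈ Icc 0 δ, ContinuousOn (σ · t) (Metric.ball p r) := by
  obtain ⟨ε, hε, a, r, L, K, hr, hpl⟩ := hf.exists_isPicardLindelof p
  obtain ⟨α, hα, L', hα'⟩ := hpl.exists_forall_mem_closedBall_eq_hasDerivWithinAt_lipschitzOnWith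
  have key : ∀ x ∈ Metric.ball p (r : ℝ),
      ENNReal.ofReal ε ≤ T x ∧ ∀ t ∈ Ico (0 : ℝ) ε, α x t = σ x t := fun x hx ↦ by
    have hx' := hα x (Metric.ball_subset_closedBall hx)
    refine hσ.maximal x ε (α x) hx'.1 fun t ht ↦ ?_
    have ht' : -ε < t := by linarith [ht.1]
    exact (hx'.2 t ⟨ht'.le, ht.2.le⟩).hasDerivAt (Icc_mem_nhds ht' ht.2)
  refine ⟨r, hr, ε / 2, half_pos hε, fun x hx ↦ lt_of_lt_of_le ?_ (key x hx).1, fun t ht ↦ ?_⟩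
  · exact (ENNReal.ofReal_lt_ofReal_iff hε).mpr (half_lt_self hε)
  · refine ((hα' t ⟨by linarith [ht.1], by linarith [ht.2]⟩).continuousOn.mono
      Metric.ball_subset_closedBall).congr fun x hx ↦ ?_
    exact ((key x hx).2 t ⟨ht.1, by linarith [ht.2]⟩).symm

/-- The domain of a maximal semiflow is open in the initial value, and the semiflow depends
continuously on the initial value. -/
lemma eventually_lt_and_continuousAt [CompleteSpace E] (hσ : IsMaximalSemiflow f σ T)
    (hf : LocallyLipschitz f) {w : E} {t : ℝ} (ht : 0 ≤ t) (htT : ENNReal.ofReal t < T w) :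
    (∀ᶠ v in 𝓝 w, ENNReal.ofReal t < T v) ∧ ContinuousAt (σ · t) w := by
  set P : ℝ → Prop := fun s ↦ (∀ᶠ v in 𝓝 w, ENNReal.ofReal s < T v) ∧ ContinuousAt (σ · s) w
  have hstep : ∀ s₀ ∈ Icc 0 t, ∃ δ > (0 : ℝ), ∀ s, 0 ≤ s → |s - s₀| < δ → P s →
      ∀ s' ∈ Icc s (s + δ), P s' := by
    intro s₀ hs₀
    obtain ⟨r, hr, δ, hδ, hT, hcont⟩ := hσ.exists_ball_continuousOn hf (σ w s₀)
    have hc : ContinuousAt (σ w) s₀ := (hσ.hasDerivAt w s₀ hs₀.1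
      ((ENNReal.ofReal_le_ofReal hs₀.2).trans_lt htT)).continuousAt
    obtain ⟨η, hη, hball⟩ := Metric.continuousAt_iff.mp hc r hr
    refine ⟨min δ η, lt_min hδ hη, fun s hs hss₀ hPs s' hs' ↦ ?_⟩
    have hws : σ w s ∈ Metric.ball (σ w s₀) r := hball (hss₀.trans_le (min_le_right _ _))
    have hh : s' - s ∈ Icc 0 δ :=
      ⟨by linarith [hs'.1], by linarith [hs'.2, min_le_left δ η]⟩
    have hev : ∀ᶠ v in 𝓝 w,
        ENNReal.ofReal s' < T v ∧ σ v s' = σ (σ v s) (s' - s) := by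
      filter_upwards [hPs.1, hPs.2 (Metric.isOpen_ball.mem_nhds hws)] with v hv hvs
      simpa using hσ.map_add hs hv hh.1 ((ENNReal.ofReal_le_ofReal hh.2).trans_lt (hT _ hvs))
    refine ⟨hev.mono fun v hv ↦ hv.1, ContinuousAt.congr ?_ (hev.mono fun v hv ↦ hv.2.symm)⟩
    exact ContinuousAt.comp (f := (σ · s)) (g := (σ · (s' - s)))
      ((hcont _ hh).continuousAt (Metric.isOpen_ball.mem_nhds hws)) hPs.2
  have hP0 : P 0 := by
    obtain ⟨r, hr, δ, hδ, hT, -⟩ := hσ.exists_ball_continuousOn hf w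
    refine ⟨?_, by simpa only [hσ.map_zero] using continuous_id'.continuousAt (x := w)⟩
    filter_upwards [Metric.ball_mem_nhds w hr] with v hv
    exact (ENNReal.ofReal_le_ofReal hδ.le).trans_lt (hT v hv)
  set A : Set ℝ := {s ∈ Icc 0 t | P s}
  have hA0 : (0 : ℝ) ∈ A := ⟨⟨le_rfl, ht⟩, hP0⟩
  have hAbdd : BddAbove A := ⟨t, fun s hs ↦ hs.1.2⟩
  have hsup0 : 0 ≤ sSup A := le_csSup hAbdd hA0
  have hsupt : sSup A ≤ t := csSup_le ⟨0, hA0⟩ fun s hs ↦ hs.1.2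
  obtain ⟨δ, hδ, hδP⟩ := hstep (sSup A) ⟨hsup0, hsupt⟩
  obtain ⟨s, hsA, hs⟩ := exists_lt_of_lt_csSup ⟨0, hA0⟩ (sub_lt_self (sSup A) (half_pos hδ))
  have hs_le : s ≤ sSup A := le_csSup hAbdd hsA
  have hreach := hδP s hsA.1.1 (by rw [abs_lt]; constructor <;> linarith) hsA.2
  by_cases hts : t ≤ s + δ
  · exact hreach t ⟨hsA.1.2, hts⟩
  · push Not at hts
    have : s + δ ∈ A :=
      ⟨⟨by linarith [hsA.1.1], hts.le⟩, hreach _ ⟨by linarith, le_rfl⟩⟩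
    linarith [le_csSup hAbdd this]

end IsMaximalSemiflow

/-- **Lemma 2.5, part 1.** If `G` is a connected invariant set of the descending flow
generated by a locally Lipschitz field `V` and `D` is an invariant set which is open in
`G`, then `C_G(D)` is open in `G`. -/
theorem lemma_2_5_part1
    {E : Type*} [NormedAddCommGroup E] [NormedSpace ℝ E] [CompleteSpace E]
    (V : E → E) (hV : LocallyLipschitz V)
    (σ : E → ℝ → E) (T₁ : E → ENNReal)
    (hσ0 : ∀ v : E, σ v 0 = v)
    (hσderiv : ∀ (v : E) (t : ℝ), 0 ≤ t → ENNReal.ofReal t < T₁ v →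
      HasDerivAt (σ v) (-V (σ v t)) t)
    (hσmax : ∀ (v : E) (T' : ℝ) (τ : ℝ → E), τ 0 = v →
      (∀ t ∈ Set.Ico (0 : ℝ) T', HasDerivAt τ (-V (τ t)) t) →
      ENNReal.ofReal T' ≤ T₁ v ∧ ∀ t ∈ Set.Ico (0 : ℝ) T', τ t = σ v t)
    (G D : Set E)
    (hG : IsFlowInvariant σ T₁ G) (hGconn : IsConnected G)
    (hD : IsFlowInvariant σ T₁ D) (hDG : D ⊆ G)
    (hDopen : ∃ U : Set E, IsOpen U ∧ D = U ∩ G) :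
    ∃ U : Set E, IsOpen U ∧ flowCG σ T₁ G D = U ∩ G := by
  have hσ : IsMaximalSemiflow (-V) σ T₁ := ⟨hσ0, hσderiv, hσmax⟩
  obtain ⟨U, hU, rfl⟩ := hDopen
  refine ⟨interior {v | v ∈ G → v ∈ flowCG σ T₁ G (U ∩ G)}, isOpen_interior,
    Subset.antisymm (fun w hw ↦ ⟨mem_interior_iff_mem_nhds.mpr ?_, hw.1⟩)
      fun w hw ↦ interior_subset hw.1 hw.2⟩
  rcases hw.2 with hwD | ⟨t, ht, htT, hwt⟩
  · filter_upwards [hU.mem_nhds hwD.1] with v hvU hvG using ⟨hvG, Or.inl ⟨hvU, hvG⟩⟩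
  · obtain ⟨hT, hcont⟩ := hσ.eventually_lt_and_continuousAt hV.neg ht.le htT
    filter_upwards [hT, hcont (hU.mem_nhds hwt.1)] with v hvT hvU hvG
    exact ⟨hvG, Or.inr ⟨t, ht, hvT, hvU, hG.2 v hvG t ht.le hvT⟩⟩

end
end

section
/- If U is a bounded connected open subset of ℝ² with (0,0) ∈ U, then there exists a connected component Γ' of the boundary ∂U such that every ray emanating from the origin meets Γ', i.e. for every unit vector e ∈ ℝ² the set {t·e : t ≥ 0} ∩ Γ' is nonempty. (Lemma 2.6) -/
open Filter Topology Set

/-- In a compact Hausdorff space, a closed set missing the connected component of `x` also misses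
some clopen neighbourhood of `x`. -/
theorem exists_isClopen_disjoint_of_disjoint_connectedComponent {X : Type*} [TopologicalSpace X]
    [CompactSpace X] [T2Space X] {x : X} {R : Set X} (hR : IsClosed R)
    (hx : Disjoint (connectedComponent x) R) : ∃ T : Set X, IsClopen T ∧ x ∈ T ∧ Disjoint T R := by
  have hcl : IsClosed ((ConnectedComponents.mk : X → _) '' R) :=
    (hR.isCompact.image ConnectedComponents.continuous_coe).isClosed
  have hmem : ConnectedComponents.mk x ∈ ((ConnectedComponents.mk : X → _) '' R)ᶜ := by
    rintro ⟨y, hy, hyx⟩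
    rw [ConnectedComponents.coe_eq_coe'] at hyx
    exact disjoint_left.1 hx hyx hy
  obtain ⟨V, hV, hxV, hVR⟩ := compact_exists_isClopen_in_isOpen hcl.isOpen_compl hmem
  refine ⟨_, hV.preimage ConnectedComponents.continuous_coe, hxV, disjoint_left.2 fun y hy hyR ↦ ?_⟩
  exact hVR hy ⟨y, hyR, rfl⟩

/-- On a compact space, a function having a continuous logarithm on a clopen neighbourhood of
every point has a global continuous logarithm. -/
theorem exists_continuous_exp_eq_of_locally_clopen {X : Type*} [TopologicalSpace X] [CompactSpace X]
    {f : X → ℂ} (hf : ∀ x, ∃ T : Set X, IsClopen T ∧ x ∈ T ∧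
      ∃ g : X → ℂ, ContinuousOn g T ∧ ∀ y ∈ T, Complex.exp (g y) = f y) :
    ∃ g : X → ℂ, Continuous g ∧ ∀ y, Complex.exp (g y) = f y := by
  classical
  have key : ∃ T : Set X, IsClopen T ∧ univ ⊆ T ∧
      ∃ g : X → ℂ, ContinuousOn g T ∧ ∀ y ∈ T, Complex.exp (g y) = f y := by
    refine isCompact_univ.induction_on (p := fun S ↦ ∃ T : Set X, IsClopen T ∧ S ⊆ T ∧
      ∃ g : X → ℂ, ContinuousOn g T ∧ ∀ y ∈ T, Complex.exp (g y) = f y) ?_ ?_ ?_ ?_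
    · exact ⟨∅, isClopen_empty, Subset.rfl, 0, by simp, by simp⟩
    · rintro S S' hS ⟨T, hT, hST, h⟩
      exact ⟨T, hT, hS.trans hST, h⟩
    · rintro S S' ⟨T, hT, hST, g, hg, hgf⟩ ⟨T', hT', hST', g', hg', hgf'⟩
      refine ⟨T ∪ T', hT.union hT', union_subset_union hST hST', T.piecewise g g', ?_, ?_⟩
      · refine ContinuousOn.piecewise ?_ ?_ ?_
        · simp [hT.frontier_eq]
        · exact hg.mono (by rw [hT.1.closure_eq]; exact inter_subset_right)
        · rw [hT.compl.1.closure_eq]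
          exact hg'.mono fun y hy ↦ hy.1.resolve_left hy.2
      · intro y hy
        by_cases hyT : y ∈ T
        · simp [hyT, hgf y hyT]
        · simp [hyT, hgf' y (hy.resolve_left hyT)]
    · intro x _
      obtain ⟨T, hT, hxT, h⟩ := hf x
      exact ⟨T, mem_nhdsWithin_of_mem_nhds (hT.2.mem_nhds hxT), T, hT, Subset.rfl, h⟩
  obtain ⟨T, -, hT, g, hg, hgf⟩ := key
  obtain rfl := univ_subset_iff.1 hT
  exact ⟨g, continuousOn_univ.1 hg, fun y ↦ hgf y trivial⟩

/-- There is no continuous logarithm of the identity on a circle centred at the origin. -/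
theorem not_exists_continuous_exp_eq_on_sphere {r : ℝ} (hr : 0 < r) {F : ℂ → ℂ}
    (hF : Continuous F) : ¬ ∀ z : ℂ, ‖z‖ = r → Complex.exp (F z) = z := by
  intro h
  set c : ℝ → ℂ := fun t ↦ r * Complex.exp (t * Complex.I) with hc
  have hexp : ∀ t, Complex.exp (F (c t)) = c t := fun t ↦ h _ (by
    simp [hc, Complex.norm_exp_ofReal_mul_I, abs_of_pos hr])
  have hlift : (fun t ↦ F (c t)) = fun t : ℝ ↦ F (c 0) + t * Complex.I := by
    refine Complex.isCoveringMap_exp.eq_of_comp_eq (by fun_prop) (by fun_prop) ?_ 0 (by simp)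
    ext t
    simp only [Function.comp_apply, Complex.exp_add, hexp]
    simp [hc]
  have h2 := congrFun hlift (2 * Real.pi)
  have hper : c (2 * Real.pi) = c 0 := by simp [hc]
  simp [hper, Real.pi_ne_zero] at h2

/-- If `w` is not on the ray spanned by `v ≠ 0`, then `-w / v` avoids the branch cut of `log`. -/
theorem Complex.neg_div_mem_slitPlane {v w : ℂ} (hv : v ≠ 0)
    (h : ∀ t : ℝ, 0 ≤ t → (t : ℂ) * v ≠ w) : -w / v ∈ Complex.slitPlane := by
  rw [Complex.mem_slitPlane_iff_not_le_zero]
  intro hle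
  obtain ⟨hre, him⟩ := Complex.le_def.1 hle
  refine h (-(-w / v).re) (by simpa using hre) ?_
  have : (((-w / v).re : ℝ) : ℂ) = -w / v := Complex.ext (by simp) (by simpa using him.symm)
  rw [Complex.ofReal_neg, this]
  field_simp

/-- **Lemma 2.6.** If `U ⊆ ℝ²` is a bounded connected open set containing the origin,
then some connected component `Γ'` of `∂U` meets every ray emanating from the origin. -/
theorem lemma_2_6
    (U : Set (EuclideanSpace ℝ (Fin 2)))
    (hUopen : IsOpen U) (hUbdd : Bornology.IsBounded U)
    (hUconn : IsConnected U) (h0 : (0 : EuclideanSpace ℝ (Fin 2)) ∈ U) :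
    ∃ Γ' : Set (EuclideanSpace ℝ (Fin 2)),
      (∃ x ∈ frontier U, Γ' = connectedComponentIn (frontier U) x) ∧
      ∀ e : EuclideanSpace ℝ (Fin 2), ‖e‖ = 1 → ∃ t : ℝ, 0 ≤ t ∧ t • e ∈ Γ' := by
  classical
  by_contra! hcon
  let φ : EuclideanSpace ℝ (Fin 2) ≃ₗᵢ[ℝ] ℂ := Complex.orthonormalBasisOneI.repr.symm
  have : CompactSpace (frontier U) := isCompact_iff_compactSpace.1
    (hUbdd.isCompact_closure.of_isClosed_subset isClosed_frontier frontier_subset_closure)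
  -- a continuous logarithm of `φ` on the boundary
  obtain ⟨g, hg, hgφ⟩ : ∃ g : frontier U → ℂ, Continuous g ∧ ∀ y, Complex.exp (g y) = φ y := by
    refine exists_continuous_exp_eq_of_locally_clopen fun x ↦ ?_
    obtain ⟨e, he, hray⟩ := hcon _ ⟨x, x.2, rfl⟩
    have he0 : φ e ≠ 0 := by
      rw [ne_eq, map_eq_zero_iff _ φ.injective]
      rintro rfl
      simp at he
    have hR : IsClosed {y : frontier U | -φ y / φ e ∉ Complex.slitPlane} :=
      (Complex.isOpen_slitPlane.preimage (f := fun y : frontier U ↦ -φ y / φ e)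
        (by fun_prop)).isClosed_compl
    obtain ⟨T, hT, hxT, hTR⟩ :=
      exists_isClopen_disjoint_of_disjoint_connectedComponent (x := x) hR <| by
        refine disjoint_left.2 fun y hy hyR ↦ hyR (Complex.neg_div_mem_slitPlane he0 ?_)
        intro t ht hty
        refine hray t ht ?_
        have hte : t • e = y := φ.injective (by simpa using hty)
        rw [hte, connectedComponentIn_eq_image x.2]
        exact mem_image_of_mem _ hy
    have hslit : ∀ y ∈ T, -φ y / φ e ∈ Complex.slitPlane :=
      fun y hy ↦ not_not.1 fun hyR ↦ disjoint_left.1 hTR hy hyR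
    refine ⟨T, hT, hxT, fun y ↦ Complex.log (-φ y / φ e) + Complex.log (-φ e), ?_, fun y hy ↦ ?_⟩
    · exact (ContinuousOn.clog (by fun_prop) hslit).add continuousOn_const
    · rw [Complex.exp_add, Complex.exp_log (Complex.slitPlane_ne_zero (hslit y hy)),
        Complex.exp_log (neg_ne_zero.2 he0)]
      field_simp
  obtain ⟨L, hL⟩ := ContinuousMap.exists_restrict_eq isClosed_frontier (⟨g, hg⟩ : C(frontier U, ℂ))
  -- extend `φ` from the complement of `U` to a nowhere vanishing function on the plane
  let G : EuclideanSpace ℝ (Fin 2) → ℂ := U.piecewise (fun x ↦ Complex.exp (L x)) φ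
  have hG : Continuous G := by
    refine Continuous.piecewise (fun x hx ↦ ?_) (by fun_prop) φ.continuous
    have hLx : L x = g ⟨x, hx⟩ := DFunLike.congr_fun hL ⟨x, hx⟩
    rw [hLx, hgφ]
  have hG0 : 0 ∉ G '' univ := by
    rintro ⟨x, -, hx⟩
    by_cases hxU : x ∈ U
    · simp [G, hxU] at hx
    · simp only [G, hxU, not_false_eq_true, piecewise_eq_of_notMem] at hx
      rw [map_eq_zero_iff _ φ.injective] at hx
      exact hxU (hx ▸ h0)
  obtain ⟨F, hF, hFG⟩ := Complex.exists_continuousOn_eqOn_exp_comp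
    ((Homeomorph.Set.univ _).toHomotopyEquiv.simplyConnectedSpace_iff.2 inferInstance)
    isOpen_univ hG.continuousOn hG0
  obtain ⟨r, hr, hUr⟩ := hUbdd.subset_ball_lt 0 0
  refine not_exists_continuous_exp_eq_on_sphere hr (F := F ∘ φ.symm)
    ((continuousOn_univ.1 hF).comp φ.symm.continuous) fun z hz ↦ ?_
  have hzU : φ.symm z ∉ U := fun hmem ↦ by
    have := hUr hmem
    simp [hz] at this
  have := hFG (mem_univ (φ.symm z))
  simpa [G, hzU] using this
end

section
/- Let X be a real reflexive Banach space, P ⊆ X a closed convex cone with P ≠ {0}, and φ : X → ℝ locally Lipschitz. If (I−∇φ)(P) ⊆ P, then m_P(x) ≥ min{1/2, m(x)}·m(x) for every x ∈ P; likewise, if (I−∇φ)(−P) ⊆ −P, then m_{−P}(x) ≥ min{1/2, m(x)}·m(x) for every x ∈ −P. (Inequalities (2.21) and (2.22)) -/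
open Filter Topology Set

noncomputable section

variable {X : Type*} [NormedAddCommGroup X] [NormedSpace ℝ X]

theorem ReflexiveSpace.exists_mem_dualityMap {X : Type*} [NormedAddCommGroup X] [NormedSpace ℝ X]
    (hrefl : ReflexiveSpace X) (xs : X →L[ℝ] ℝ) : ∃ w, w ∈ dualityMap xs := by
  rcases eq_or_ne xs 0 with rfl | hxs
  · exact ⟨0, by simp [dualityMap]⟩
  obtain ⟨g, hg, hgx⟩ := exists_dual_vector ℝ xs (norm_ne_zero_iff.mpr hxs)
  obtain ⟨u, rfl⟩ := hrefl g
  have hu : ‖u‖ = 1 := by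
    rw [← hg]
    exact ((NormedSpace.inclusionInDoubleDualLi ℝ (E := X)).norm_map u).symm
  have hxu : xs u = ‖xs‖ := by simpa using hgx
  refine ⟨‖xs‖ • u, ?_, ?_⟩
  · simp [hxu, sq]
  · simp [norm_smul, hu]

theorem mSlope_nonneg {X : Type*} [NormedAddCommGroup X] [NormedSpace ℝ X]
    (φ : X → ℝ) (x : X) : 0 ≤ mSlope φ x :=
  Real.sInf_nonneg (by rintro _ ⟨xs, -, rfl⟩; exact norm_nonneg xs)

theorem mSlope_le_norm {X : Type*} [NormedAddCommGroup X] [NormedSpace ℝ X]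
    {φ : X → ℝ} {x : X} {xs : X →L[ℝ] ℝ} (hxs : xs ∈ clarkeSubdiff φ x) :
    mSlope φ x ≤ ‖xs‖ :=
  csInf_le ⟨0, by rintro _ ⟨ys, -, rfl⟩; exact norm_nonneg ys⟩ ⟨xs, hxs, rfl⟩

theorem le_sSup_apply_sub {X : Type*} [NormedAddCommGroup X] [NormedSpace ℝ X]
    {C : Set X} {x y : X} (xs : X →L[ℝ] ℝ) (hy : y ∈ C) (hxy : ‖x - y‖ < 1) :
    xs (x - y) ≤ sSup {s | ∃ y ∈ C, ‖x - y‖ < 1 ∧ s = xs (x - y)} := by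
  refine le_csSup ⟨‖xs‖, ?_⟩ ⟨y, hy, hxy, rfl⟩
  rintro _ ⟨z, -, hz, rfl⟩
  exact (le_abs_self _).trans (xs.unit_le_opNorm _ hz.le)

/-- The slope inequality holds on every convex set with the Schauder invariance property. -/
theorem SchauderInv.min_mul_mSlope_le_mCSlope {X : Type*} [NormedAddCommGroup X]
    [NormedSpace ℝ X] (hrefl : ReflexiveSpace X) {C : Set X} (hC : Convex ℝ C) {φ : X → ℝ}
    (hinv : SchauderInv φ C) {x : X} (hx : x ∈ C) :
    min (1 / 2) (mSlope φ x) * mSlope φ x ≤ mCSlope φ C x := by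
  have hm := mSlope_nonneg φ x
  rcases (clarkeSubdiff φ x).eq_empty_or_nonempty with he | ⟨xs₀, hxs₀⟩
  · simp [mSlope, mCSlope, he]
  refine le_csInf ⟨_, xs₀, hxs₀, rfl⟩ ?_
  rintro _ ⟨xs, hxs, rfl⟩
  have hmr := mSlope_le_norm hxs
  obtain ⟨w, hw, hwn⟩ := hrefl.exists_mem_dualityMap xs
  have hwn' : ‖w‖ = ‖xs‖ := (sq_eq_sq₀ (norm_nonneg _) (norm_nonneg _)).mp hwn
  have hxw : x - w ∈ C := hinv x hx w (mem_biUnion hxs ⟨hw, hwn⟩)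
  have key : ∀ t : ℝ, 0 ≤ t → t ≤ 1 → t * ‖xs‖ < 1 →
      t * ‖xs‖ ^ 2 ≤ sSup {s | ∃ y ∈ C, ‖x - y‖ < 1 ∧ s = xs (x - y)} := by
    intro t ht0 ht1 ht
    have hmem : x - t • w ∈ C := by
      simpa [sub_eq_add_neg] using hC.add_smul_mem hx (y := -w) (by rwa [← sub_eq_add_neg])
        ⟨ht0, ht1⟩
    have := le_sSup_apply_sub (x := x) xs hmem
      (by rwa [sub_sub_cancel, norm_smul, Real.norm_of_nonneg ht0, hwn'])
    rwa [sub_sub_cancel, map_smul, hw, smul_eq_mul] at this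
  rcases lt_or_ge ‖xs‖ 1 with hr | hr
  · calc min (1 / 2) (mSlope φ x) * mSlope φ x ≤ mSlope φ x * mSlope φ x := by
          gcongr; exact min_le_right _ _
      _ ≤ 1 * ‖xs‖ ^ 2 := by nlinarith
      _ ≤ _ := key 1 zero_le_one le_rfl (by simpa using hr)
  · have hr0 : 0 < ‖xs‖ := by linarith
    calc min (1 / 2) (mSlope φ x) * mSlope φ x ≤ 1 / 2 * ‖xs‖ := by
          gcongr; exact min_le_left _ _
      _ = 1 / (2 * ‖xs‖) * ‖xs‖ ^ 2 := by field_simp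
      _ ≤ _ := key _ (by positivity) (by rw [div_le_one (by positivity)]; linarith)
          (by field_simp; norm_num)

/-- **Inequalities (2.21) and (2.22).** Under the Schauder invariance condition
`(I-∇φ)(±P) ⊆ ±P` one has `m_{±P}(x) ≥ min{1/2, m(x)}·m(x)` on `±P`. -/
theorem inequalities_2_21_2_22
    {X : Type*} [NormedAddCommGroup X] [NormedSpace ℝ X]
    (hrefl : ReflexiveSpace X)
    (P : Set X) (hPcl : IsClosed P) (hPconv : Convex ℝ P)
    (hPcone : ∀ t : ℝ, 0 ≤ t → ∀ x ∈ P, t • x ∈ P)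
    (hPpoint : P ∩ (Neg.neg ⁻¹' P) = {0})
    (hPne : P ≠ {0})
    (φ : X → ℝ) (hφ : LocallyLipschitz φ) :
    (SchauderInv φ P →
      ∀ x ∈ P, min (1 / 2) (mSlope φ x) * mSlope φ x ≤ mCSlope φ P x) ∧
    (SchauderInv φ (Neg.neg ⁻¹' P) →
      ∀ x ∈ Neg.neg ⁻¹' P,
        min (1 / 2) (mSlope φ x) * mSlope φ x ≤ mCSlope φ (Neg.neg ⁻¹' P) x) := by
  exact ⟨fun h _ hx => h.min_mul_mSlope_le_mCSlope hrefl hPconv hx,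
    fun h _ hx => h.min_mul_mSlope_le_mCSlope hrefl hPconv.neg hx⟩

end
end

section
/- If M ⊆ E is a closed invariant set of descending flow of J, α = inf_{u∈M} J(u) > −∞, and J satisfies the (PS) condition on M, then α is a critical value of J: there exists u₀ ∈ M with J'(u₀) = 0 and J(u₀) = α. (Theorem 1.1) -/
open Filter Topology Set

section MeanValue

variable {F : Type*} [NormedAddCommGroup F] [NormedSpace ℝ F]

/-- A curve whose speed is dominated by the rate of decrease of `ψ` moves at most as far as `ψ`
decreases. -/
lemma dist_le_sub_of_norm_deriv_le_neg {γ γ' : ℝ → F} {ψ ψ' : ℝ → ℝ} {I : Set ℝ}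
    (hI : I.OrdConnected) (hγ : ∀ t ∈ I, HasDerivAt γ (γ' t) t)
    (hψ : ∀ t ∈ I, HasDerivAt ψ (ψ' t) t) (h : ∀ t ∈ I, ‖γ' t‖ ≤ -ψ' t)
    {s t : ℝ} (hs : s ∈ I) (ht : t ∈ I) (hst : s ≤ t) :
    dist (γ s) (γ t) ≤ ψ s - ψ t := by
  have hsub : Icc s t ⊆ I := hI.out hs ht
  rw [dist_comm, dist_eq_norm]
  refine image_norm_le_of_norm_deriv_right_le_deriv_boundary'
    (f := fun x => γ x - γ s) (f' := γ') (B := fun x => ψ s - ψ x) (B' := fun x => -ψ' x)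
    (a := s) (b := t) ?_ ?_ (by simp) ?_ ?_ ?_ (right_mem_Icc.2 hst)
  · exact fun x hx => ((hγ x (hsub hx)).sub_const _).continuousAt.continuousWithinAt
  · exact fun x hx => ((hγ x (hsub (Ico_subset_Icc_self hx))).sub_const _).hasDerivWithinAt
  · exact fun x hx => ((hψ x (hsub hx)).const_sub _).continuousAt.continuousWithinAt
  · exact fun x hx => ((hψ x (hsub (Ico_subset_Icc_self hx))).const_sub _).hasDerivWithinAt
  · exact fun x hx => h x (hsub (Ico_subset_Icc_self hx))

end MeanValue

/-- A curve on `[a, b)` whose displacement is controlled by the decrease of a function bounded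
below has a limit at `b`. -/
lemma exists_tendsto_nhdsLT_of_dist_le_sub {X : Type*} [PseudoMetricSpace X] [CompleteSpace X]
    {γ : ℝ → X} {ψ : ℝ → ℝ} {a b : ℝ} (hab : a < b) (hψ : BddBelow (ψ '' Ico a b))
    (h : ∀ s ∈ Ico a b, ∀ t ∈ Ico a b, s ≤ t → dist (γ s) (γ t) ≤ ψ s - ψ t) :
    ∃ z, Tendsto γ (𝓝[<] b) (𝓝 z) := by
  refine cauchy_map_iff_exists_tendsto.1 (Metric.cauchy_iff.2 ⟨inferInstance, fun ε hε => ?_⟩)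
  obtain ⟨_, ⟨c, hc, rfl⟩, hlt⟩ := exists_lt_of_csInf_lt
    ((nonempty_Ico.2 hab).image ψ) (lt_add_of_pos_right (sInf (ψ '' Ico a b)) hε)
  have key : ∀ s ∈ Ico c b, ∀ t ∈ Ico c b, s ≤ t → dist (γ s) (γ t) < ε := by
    intro s hs t ht hst
    have hs' : s ∈ Ico a b := ⟨hc.1.trans hs.1, hs.2⟩
    have ht' : t ∈ Ico a b := ⟨hc.1.trans ht.1, ht.2⟩
    have h1 := h s hs' t ht' hst
    have h2 : ψ s ≤ ψ c := sub_nonneg.1 (dist_nonneg.trans (h c hc s hs' hs.1))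
    have h3 : sInf (ψ '' Ico a b) ≤ ψ t := csInf_le hψ (mem_image_of_mem ψ ht')
    linarith
  refine ⟨γ '' Ico c b, image_mem_map (Ico_mem_nhdsLT hc.2), ?_⟩
  rintro _ ⟨s, hs, rfl⟩ _ ⟨t, ht, rfl⟩
  rcases le_total s t with hst | hts
  · exact key s hs t ht hst
  · rw [dist_comm]
    exact key t ht s hs hts

section ODE

variable {E : Type*} [NormedAddCommGroup E] [NormedSpace ℝ E] [CompleteSpace E]

/-- Local existence for a vector field that is Lipschitz near the initial point. -/
lemma LipschitzOnWith.exists_forall_mem_Ioo_hasDerivAt {v : E → E} {z : E} {K : NNReal} {s : Set E}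
    (hs : s ∈ 𝓝 z) (hv : LipschitzOnWith K v s) {U : Set E} (hU : U ∈ 𝓝 z) :
    ∃ α : ℝ → E, α 0 = z ∧ ∃ ε > 0, ∀ t ∈ Ioo (-ε) ε, α t ∈ U ∧ HasDerivAt α (v (α t)) t := by
  obtain ⟨a, ha, has⟩ := Metric.nhds_basis_closedBall.mem_iff.1 hs
  have hb : ∀ x ∈ Metric.closedBall z a, ‖v x‖ ≤ K * a + ‖v z‖ + 1 := by
    intro x hx
    have h1 : ‖v x - v z‖ ≤ K * ‖x - z‖ := hv.norm_sub_le (has hx) (mem_of_mem_nhds hs)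
    have h2 : K * ‖x - z‖ ≤ K * a := by
      gcongr
      exact mem_closedBall_iff_norm.1 hx
    linarith [norm_le_norm_sub_add (v x) (v z)]
  set L : ℝ := K * a + ‖v z‖ + 1
  have hL : 0 < L := by positivity
  have hε : 0 < a / L := by positivity
  have hpl : IsPicardLindelof (fun _ => v) (tmin := -(a / L)) (tmax := a / L)
      ⟨0, by constructor <;> linarith⟩ z ⟨a, ha.le⟩ 0 ⟨L, hL.le⟩ K := by
    refine .of_time_independent hb (hv.mono has) ?_
    simp only [sub_zero, zero_sub, neg_neg, max_self]
    change L * (a / L) ≤ a - 0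
    rw [mul_div_cancel₀ _ hL.ne', sub_zero]
  obtain ⟨α, hα0, hα⟩ := hpl.exists_eq_forall_mem_Icc_hasDerivWithinAt₀
  have hd : ∀ t ∈ Ioo (-(a / L)) (a / L), HasDerivAt α (v (α t)) t := fun t ht =>
    (hα t (Ioo_subset_Icc_self ht)).hasDerivAt (Icc_mem_nhds ht.1 ht.2)
  have hcont : ContinuousAt α 0 := (hd 0 ⟨by linarith, hε⟩).continuousAt
  have hmem : α ⁻¹' U ∈ 𝓝 (0 : ℝ) := hcont (by rwa [show α 0 = z from hα0])
  obtain ⟨η, hη, hηU⟩ := Metric.mem_nhds_iff.1 hmem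
  rw [Real.ball_eq_Ioo, zero_sub, zero_add] at hηU
  refine ⟨α, hα0, min η (a / L), lt_min hη hε, fun t ht => ⟨hηU ⟨?_, ?_⟩, hd t ⟨?_, ?_⟩⟩⟩
  all_goals
    have h1 := min_le_left η (a / L)
    have h2 := min_le_right η (a / L)
    obtain ⟨h3, h4⟩ := ht
    linarith

/-- An integral curve on `[0, b)` that converges at `b` to a point near which the vector field is
Lipschitz can be continued beyond `b`. -/
lemma exists_hasDerivAt_extension {v : E → E} {z : E} {K : NNReal} {s : Set E}
    (hs : s ∈ 𝓝 z) (hv : LipschitzOnWith K v s) {U : Set E} (hU : U ∈ 𝓝 z)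
    {γ : ℝ → E} {b : ℝ} (hb : 0 < b)
    (hγ : ∀ t ∈ Ico 0 b, γ t ∈ U ∧ HasDerivAt γ (v (γ t)) t)
    (hlim : Tendsto γ (𝓝[<] b) (𝓝 z)) :
    ∃ c > b, ∃ τ : ℝ → E, τ 0 = γ 0 ∧
      ∀ t ∈ Ico 0 c, τ t ∈ U ∧ HasDerivAt τ (v (τ t)) t := by
  obtain ⟨α, hα0, ε, hε, hα⟩ := hv.exists_forall_mem_Ioo_hasDerivAt hs hU
  set τ : ℝ → E := fun t => if t < b then γ t else α (t - b)
  have hlt : ∀ t < b, τ t = γ t := fun t ht => if_pos ht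
  have hge : ∀ t, b ≤ t → τ t = α (t - b) := fun t ht => if_neg ht.not_gt
  have hshift : ∀ t ∈ Ico b (b + ε),
      α (t - b) ∈ U ∧ HasDerivAt (fun x => α (x - b)) (v (α (t - b))) t := by
    intro t ht
    obtain ⟨h1, h2⟩ := hα (t - b) ⟨by linarith [ht.1], by linarith [ht.2]⟩
    exact ⟨h1, h2.comp_sub_const t b⟩
  have hτlt : ∀ t ∈ Ico 0 b, HasDerivAt τ (v (τ t)) t := fun t ht => by
    rw [hlt t ht.2]
    exact (hγ t ht).2.congr_of_eventuallyEq
      (eventually_of_mem (Iio_mem_nhds ht.2) fun x hx => hlt x hx)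
  have hτb : τ b = z := by rw [hge b le_rfl, sub_self, hα0]
  have hτlim : Tendsto τ (𝓝[<] b) (𝓝 (τ b)) := by
    rw [hτb]
    exact hlim.congr' (eventually_of_mem self_mem_nhdsWithin fun x hx => (hlt x hx).symm)
  have hIoo : Ioo 0 b ∈ 𝓝[<] b := Ioo_mem_nhdsLT hb
  refine ⟨b + ε, by linarith, τ, hlt 0 hb, fun t ht => ?_⟩
  rcases lt_trichotomy t b with h | rfl | h
  · exact ⟨by rw [hlt t h]; exact (hγ t ⟨ht.1, h⟩).1, hτlt t ⟨ht.1, h⟩⟩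
  · refine ⟨by rw [hτb]; exact mem_of_mem_nhds hU, ?_⟩
    have hleft : HasDerivWithinAt τ (v (τ t)) (Iic t) t := by
      refine hasDerivWithinAt_Iic_of_tendsto_deriv (s := Ioo 0 t)
        (fun x hx => (hτlt x (Ioo_subset_Ico_self hx)).differentiableAt.differentiableWithinAt)
        (hτlim.mono_left (nhdsWithin_mono _ Ioo_subset_Iio_self)) hIoo ?_
      have hvc : ContinuousAt v (τ t) := by
        rw [hτb]
        exact hv.continuousOn.continuousAt hs
      exact (hvc.tendsto.comp hτlim).congr'
        (eventually_of_mem hIoo fun x hx => (hτlt x (Ioo_subset_Ico_self hx)).deriv.symm)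
    have hright : HasDerivWithinAt τ (v (τ t)) (Ici t) t := by
      have h := (hshift t ⟨le_rfl, by linarith⟩).2.hasDerivWithinAt (s := Ici t)
      rw [← hge t le_rfl] at h
      exact h.congr (fun x hx => hge x hx) (hge t le_rfl)
    simpa using hleft.union hright
  · obtain ⟨h1, h2⟩ := hshift t ⟨h.le, ht.2⟩
    rw [hge t h.le]
    exact ⟨h1, h2.congr_of_eventuallyEq
      (eventually_of_mem (Ioi_mem_nhds h) fun x hx => hge x (le_of_lt hx))⟩

end ODE

section PseudoGradient

variable {E : Type*} [NormedAddCommGroup E] [NormedSpace ℝ E]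

/-- Along a descending pseudo-gradient curve on which `J'` stays at norm at least `δ`, `J` decreases
at rate at least `δ ^ 2`, and the length of the curve is at most `2 / δ` times the decrease. -/
lemma pseudoGradient_curve_estimates {J : E → ℝ} (hJ : Differentiable ℝ J) {W : E → E}
    {γ : ℝ → E} {I : Set ℝ} (hI : I.OrdConnected) {δ : ℝ} (hδ : 0 < δ)
    (hγ : ∀ t ∈ I, HasDerivAt γ (-W (γ t)) t)
    (hW1 : ∀ t ∈ I, ‖W (γ t)‖ ≤ 2 * ‖fderiv ℝ J (γ t)‖)
    (hW2 : ∀ t ∈ I, ‖fderiv ℝ J (γ t)‖ ^ 2 ≤ fderiv ℝ J (γ t) (W (γ t)))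
    (hδJ : ∀ t ∈ I, δ ≤ ‖fderiv ℝ J (γ t)‖)
    {s t : ℝ} (hs : s ∈ I) (ht : t ∈ I) (hst : s ≤ t) :
    δ ^ 2 * (t - s) ≤ J (γ s) - J (γ t) ∧
      dist (γ s) (γ t) ≤ 2 / δ * J (γ s) - 2 / δ * J (γ t) := by
  have hJγ : ∀ t ∈ I, HasDerivAt (fun t => J (γ t)) (fderiv ℝ J (γ t) (-W (γ t))) t :=
    fun t ht => (hJ (γ t)).hasFDerivAt.comp_hasDerivAt t (hγ t ht)
  constructor
  · have h := dist_le_sub_of_norm_deriv_le_neg (γ := fun t => t * δ ^ 2) (γ' := fun _ => δ ^ 2)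
      hI (fun t _ => by simpa using (hasDerivAt_id t).mul_const (δ ^ 2)) hJγ
      (fun t ht => by
        rw [map_neg, neg_neg, Real.norm_of_nonneg (by positivity)]
        exact (pow_le_pow_left₀ hδ.le (hδJ t ht) 2).trans (hW2 t ht)) hs ht hst
    rw [dist_comm, Real.dist_eq] at h
    linarith [le_abs_self (t * δ ^ 2 - s * δ ^ 2)]
  · refine dist_le_sub_of_norm_deriv_le_neg hI hγ (fun t ht => (hJγ t ht).const_mul (2 / δ))
      (fun t ht => ?_) hs ht hst
    rw [map_neg, mul_neg, neg_neg, norm_neg, div_mul_eq_mul_div, le_div_iff₀ hδ]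
    have h1 := mul_le_mul (hW1 t ht) (hδJ t ht) hδ.le (by positivity)
    linarith [hW2 t ht, h1]

end PseudoGradient

/-- **Theorem 1.1.** If `M` is a closed invariant set of the descending flow of a
`C¹` functional `J`, `α = inf_M J > -∞` and `J` satisfies (PS) on `M`, then `α` is a
critical value of `J`, attained at some `u₀ ∈ M`. -/
theorem theorem_1_1
    {E : Type*} [NormedAddCommGroup E] [NormedSpace ℝ E] [CompleteSpace E]
    (J : E → ℝ) (hJ : ContDiff ℝ 1 J)
    (W : E → E)
    -- `W` is a locally Lipschitz pseudo-gradient vector field of `J` on `E₀ = E \ K`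
    (hWlip : ∀ u : E, fderiv ℝ J u ≠ 0 →
      ∃ K' : NNReal, ∃ t ∈ 𝓝 u, LipschitzOnWith K' W t)
    (hW1 : ∀ u : E, fderiv ℝ J u ≠ 0 → ‖W u‖ ≤ 2 * ‖fderiv ℝ J u‖)
    (hW2 : ∀ u : E, fderiv ℝ J u ≠ 0 → ‖fderiv ℝ J u‖ ^ 2 ≤ fderiv ℝ J u (W u))
    -- the right-maximal descending flow `u(t, u₀)` of `du/dt = -W(u)`
    (σ : E → ℝ → E) (T : E → ENNReal)
    (hσ0 : ∀ u : E, σ u 0 = u)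
    (hσderiv : ∀ u : E, fderiv ℝ J u ≠ 0 → ∀ t : ℝ, 0 ≤ t → ENNReal.ofReal t < T u →
      fderiv ℝ J (σ u t) ≠ 0 ∧ HasDerivAt (σ u) (-W (σ u t)) t)
    (hσmax : ∀ u : E, fderiv ℝ J u ≠ 0 → ∀ (T' : ℝ) (τ : ℝ → E), τ 0 = u →
      (∀ t ∈ Set.Ico (0 : ℝ) T', fderiv ℝ J (τ t) ≠ 0 ∧ HasDerivAt τ (-W (τ t)) t) →
      ENNReal.ofReal T' ≤ T u ∧ ∀ t ∈ Set.Ico (0 : ℝ) T', τ t = σ u t)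
    -- `M` is a nonempty closed invariant set of descending flow
    (M : Set E) (hMne : M.Nonempty) (hMcl : IsClosed M)
    (hMinv : ∀ u ∈ M, fderiv ℝ J u ≠ 0 → ∀ t : ℝ, 0 ≤ t →
      ENNReal.ofReal t < T u → σ u t ∈ M)
    -- `α = inf_M J > -∞`
    (hbdd : BddBelow (J '' M))
    -- (PS) condition on `M`
    (hPS : ∀ u : ℕ → E, (∀ n, u n ∈ M) → (∃ b : ℝ, ∀ n, |J (u n)| ≤ b) →
      Tendsto (fun n => ‖fderiv ℝ J (u n)‖) atTop (𝓝 0) →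
      ∃ z : E, ∃ s : ℕ → ℕ, StrictMono s ∧ Tendsto (fun n => u (s n)) atTop (𝓝 z)) :
    ∃ u₀ ∈ M, fderiv ℝ J u₀ = 0 ∧ J u₀ = sInf (J '' M) := by
  set U : Set E := {u | fderiv ℝ J u ≠ 0}
  have hcont : Continuous (fderiv ℝ J) := hJ.continuous_fderiv one_ne_zero
  have hU : IsOpen U := isOpen_ne_fun hcont continuous_const
  have hlow : ∀ x ∈ M, sInf (J '' M) ≤ J x := fun x hx => csInf_le hbdd (mem_image_of_mem J hx)
  have almost : ∀ u ∈ M, ∀ δ > 0, ∃ v ∈ M, J v ≤ J u ∧ ‖fderiv ℝ J v‖ < δ := by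
    intro u hu δ hδ
    by_cases hKu : fderiv ℝ J u = 0
    · exact ⟨u, hu, le_rfl, by simpa [hKu]⟩
    by_contra! hno
    set I : Set ℝ := {t | 0 ≤ t ∧ ENNReal.ofReal t < T u}
    have hI : I.OrdConnected := ⟨fun s hs t ht x hx =>
      ⟨hs.1.trans hx.1, (ENNReal.ofReal_le_ofReal hx.2).trans_lt ht.2⟩⟩
    have hsolve : ∀ z ∈ U, ∃ K' : NNReal, ∃ s ∈ 𝓝 z, LipschitzOnWith K' (fun x => -W x) s := by
      intro z hz
      obtain ⟨K', s, hs, hWs⟩ := hWlip z hz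
      exact ⟨K', s, hs, hWs.neg⟩
    have hpos : 0 < T u := by
      obtain ⟨K', s, hs, hWs⟩ := hsolve u hKu
      obtain ⟨α, hα0, ε, hε, hα⟩ := hWs.exists_forall_mem_Ioo_hasDerivAt hs (hU.mem_nhds hKu)
      exact (ENNReal.ofReal_pos.2 hε).trans_le
        (hσmax u hKu ε α hα0 fun t ht => hα t ⟨by linarith [ht.1], ht.2⟩).1
    have h0 : (0 : ℝ) ∈ I := ⟨le_rfl, by simpa using hpos⟩
    have hIM : ∀ t ∈ I, σ u t ∈ M := fun t ht => hMinv u hu hKu t ht.1 ht.2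
    have hID : ∀ t ∈ I, σ u t ∈ U ∧ HasDerivAt (σ u) (-W (σ u t)) t :=
      fun t ht => hσderiv u hKu t ht.1 ht.2
    have hlevel : ∀ t ∈ I, J (σ u t) ≤ J u := by
      intro t ht
      have h := dist_le_sub_of_norm_deriv_le_neg (γ := fun _ => (0 : ℝ)) (γ' := fun _ => 0)
        (ψ := fun t => J (σ u t)) hI (fun t _ => hasDerivAt_const t 0)
        (fun t ht => (hJ.differentiable one_ne_zero (σ u t)).hasFDerivAt.comp_hasDerivAt t
          (hID t ht).2)
        (fun t ht => by
          rw [map_neg, neg_neg, norm_zero]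
          exact (sq_nonneg _).trans (hW2 _ (hID t ht).1)) h0 ht ht.1
      rw [dist_self, hσ0] at h
      linarith
    have est := fun s (hs : s ∈ I) t (ht : t ∈ I) (hst : s ≤ t) =>
      pseudoGradient_curve_estimates (hJ.differentiable one_ne_zero) hI hδ (fun t ht => (hID t ht).2)
        (fun t ht => hW1 _ (hID t ht).1) (fun t ht => hW2 _ (hID t ht).1)
        (fun t ht => hno _ (hIM t ht) (hlevel t ht)) hs ht hst
    have hfin : T u ≠ ⊤ := by
      intro htop
      have hC : 0 ≤ (J u - sInf (J '' M)) / δ ^ 2 :=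
        div_nonneg (sub_nonneg.2 (hlow u hu)) (sq_nonneg δ)
      have ht : (J u - sInf (J '' M)) / δ ^ 2 + 1 ∈ I :=
        ⟨by linarith, by rw [htop]; exact ENNReal.ofReal_lt_top⟩
      have h := (est 0 h0 _ ht ht.1).1
      rw [sub_zero, mul_add, mul_div_cancel₀ _ (by positivity), hσ0] at h
      nlinarith [hlow _ (hIM _ ht), pow_pos hδ 2]
    set b := (T u).toReal
    have hb : 0 < b := ENNReal.toReal_pos hpos.ne' hfin
    have hIb : ∀ t ∈ Ico 0 b, t ∈ I := fun t ht =>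
      ⟨ht.1, (ENNReal.ofReal_lt_iff_lt_toReal ht.1 hfin).2 ht.2⟩
    obtain ⟨z, hz⟩ := exists_tendsto_nhdsLT_of_dist_le_sub (γ := σ u)
      (ψ := fun t => 2 / δ * J (σ u t)) hb
      ⟨2 / δ * sInf (J '' M), by
        rintro _ ⟨t, ht, rfl⟩
        exact mul_le_mul_of_nonneg_left (hlow _ (hIM t (hIb t ht))) (by positivity)⟩
      (fun s hs t ht hst => (est s (hIb s hs) t (hIb t ht) hst).2)
    have hzU : z ∈ U := by
      have hle : δ ≤ ‖fderiv ℝ J z‖ :=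
        ge_of_tendsto ((hcont.norm.tendsto z).comp hz)
          (eventually_of_mem (Ico_mem_nhdsLT hb) fun t ht =>
            hno _ (hIM t (hIb t ht)) (hlevel t (hIb t ht)))
      exact norm_pos_iff.1 (hδ.trans_le hle)
    obtain ⟨K', s, hs, hWs⟩ := hsolve z hzU
    obtain ⟨c, hc, τ, hτ0, hτ⟩ := exists_hasDerivAt_extension hs hWs (hU.mem_nhds hzU) hb
      (fun t ht => hID t (hIb t ht)) hz
    have hle := (hσmax u hKu c τ (hτ0.trans (hσ0 u)) hτ).1
    exact hc.not_ge ((ENNReal.ofReal_le_iff_le_toReal hfin).1 hle)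
  obtain ⟨x, -, hx, hxM⟩ := exists_seq_tendsto_sInf (hMne.image J) hbdd
  choose w hwM hwx using hxM
  choose v hvM hvJ hvd using fun n : ℕ => almost (w n) (hwM n) _ (Nat.one_div_pos_of_nat (n := n))
  have hvlim : Tendsto (fun n => J (v n)) atTop (𝓝 (sInf (J '' M))) :=
    tendsto_of_tendsto_of_tendsto_of_le_of_le tendsto_const_nhds hx
      (fun n => hlow _ (hvM n)) (fun n => (hvJ n).trans (hwx n).le)
  have hdlim : Tendsto (fun n => ‖fderiv ℝ J (v n)‖) atTop (𝓝 0) :=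
    squeeze_zero (fun n => norm_nonneg _) (fun n => (hvd n).le)
      tendsto_one_div_add_atTop_nhds_zero_nat
  obtain ⟨B, hB⟩ := (Metric.isBounded_range_of_tendsto _ hvlim).exists_norm_le
  obtain ⟨z, s, hs, hz⟩ := hPS v hvM ⟨B, fun n => hB _ (mem_range_self n)⟩ hdlim
  refine ⟨z, hMcl.mem_of_tendsto hz (Eventually.of_forall fun n => hvM _), ?_, ?_⟩
  · exact norm_eq_zero.1 (tendsto_nhds_unique ((hcont.norm.tendsto z).comp hz)
      (hdlim.comp hs.tendsto_atTop))
  · exact tendsto_nhds_unique ((hJ.continuous.tendsto z).comp hz) (hvlim.comp hs.tendsto_atTop)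
end

section
/- Let j : ℝ → ℝ be locally Lipschitz, and let μ > 0 and M > 0 be such that j(M) > 0 and μ·j(z) ≤ −j⁰(z; −z) for all z ≥ M. Then j(z) ≥ (z/M)^μ · j(M) for all z ≥ M. (Pointwise growth estimate derived in the proof of Lemma 3.3) -/
open Filter Topology Set

noncomputable section

variable {X : Type*} [NormedAddCommGroup X] [NormedSpace ℝ X]

/-- The difference quotients defining `clarkeDeriv` are locally bounded above. -/
theorem isBoundedUnder_clarkeQuotient {φ : X → ℝ} (hφ : LocallyLipschitz φ) (x h : X) :
    IsBoundedUnder (· ≤ ·) ((𝓝 x) ×ˢ (𝓝[>] (0 : ℝ)))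
      (fun p : X × ℝ => (φ (p.1 + p.2 • h) - φ p.1) / p.2) := by
  obtain ⟨K, t, ht, hK⟩ := hφ x
  have hfst : Tendsto (fun p : X × ℝ => p.1) ((𝓝 x) ×ˢ (𝓝[>] (0 : ℝ))) (𝓝 x) := tendsto_fst
  have hsnd : Tendsto (fun p : X × ℝ => p.2) ((𝓝 x) ×ˢ (𝓝[>] (0 : ℝ))) (𝓝[>] 0) :=
    tendsto_snd
  have hadd : Tendsto (fun p : X × ℝ => p.1 + p.2 • h) ((𝓝 x) ×ˢ (𝓝[>] (0 : ℝ))) (𝓝 x) := by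
    simpa using hfst.add ((hsnd.mono_right nhdsWithin_le_nhds).smul_const h)
  refine ⟨K * ‖h‖, eventually_map.2 ?_⟩
  filter_upwards [hfst.eventually ht, hadd.eventually ht, hsnd.eventually self_mem_nhdsWithin]
    with p h₁ h₂ hpos
  replace hpos : 0 < p.2 := hpos
  rw [div_le_iff₀ hpos]
  calc φ (p.1 + p.2 • h) - φ p.1 ≤ dist (φ (p.1 + p.2 • h)) (φ p.1) := le_abs_self _
    _ ≤ K * dist (p.1 + p.2 • h) p.1 := hK.dist_le_mul _ h₂ _ h₁
    _ = K * ‖h‖ * p.2 := by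
      rw [dist_self_add_left, norm_smul, Real.norm_of_nonneg hpos.le]
      ring

/-- At a positive point, the generalized directional derivative towards the origin bounds the right
slopes of `-j`. -/
theorem eventually_slope_neg_lt_of_clarkeDeriv_lt {j : ℝ → ℝ} (hj : LocallyLipschitz j)
    {x r : ℝ} (hx : 0 < x) (hr : clarkeDeriv j x (-x) < x * r) :
    ∀ᶠ z in 𝓝[>] x, slope (fun y => -j y) x z < r := by
  have hquot := eventually_lt_of_limsup_lt hr (isBoundedUnder_clarkeQuotient hj x (-x))
  have hstep : Tendsto (fun z : ℝ => (z - x) / x) (𝓝[>] x) (𝓝[>] 0) := by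
    refine tendsto_nhdsWithin_iff.2 ⟨?_, ?_⟩
    · have hcont : Continuous fun z : ℝ => (z - x) / x := by fun_prop
      simpa using (hcont.tendsto x).mono_left nhdsWithin_le_nhds
    · filter_upwards [self_mem_nhdsWithin] with z hz
      exact div_pos (sub_pos.2 hz) hx
  have hid : Tendsto (fun z : ℝ => z) (𝓝[>] x) (𝓝 x) := nhdsWithin_le_nhds
  filter_upwards [(hid.prodMk hstep).eventually hquot, self_mem_nhdsWithin] with z hz hxz
  have hzx : 0 < z - x := sub_pos.2 hxz
  have hback : z + (z - x) / x * -x = x := by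
    field_simp
    ring
  rw [smul_eq_mul, hback] at hz
  rw [slope_def_field]
  refine lt_of_mul_lt_mul_left (lt_of_eq_of_lt ?_ hz) hx.le
  field_simp
  ring

/-- The growth estimate with a strictly smaller exponent. -/
theorem rpow_mul_le_of_lt_exponent {j : ℝ → ℝ} (hj : LocallyLipschitz j)
    {μ ν M : ℝ} (hνμ : ν < μ) (hM : 0 < M) (hjM : 0 < j M)
    (hsub : ∀ z : ℝ, M ≤ z → μ * j z ≤ -clarkeDeriv j z (-z)) {z : ℝ} (hz : M ≤ z) :
    (z / M) ^ ν * j M ≤ j z := by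
  have hderiv : ∀ x, M ≤ x → HasDerivAt (fun y => -((y / M) ^ ν * j M))
      (-(ν / x * ((x / M) ^ ν * j M))) x := by
    intro x hx
    have hx0 : 0 < x := hM.trans_le hx
    have hxM : x / M ≠ 0 := (div_pos hx0 hM).ne'
    refine ((((hasDerivAt_id x).div_const M).rpow_const (p := ν)
      (Or.inl hxM)).mul_const (j M)).neg.congr_deriv ?_
    simp only [id]
    rw [Real.rpow_sub_one hxM]
    field_simp
  refine neg_le_neg_iff.1 (image_le_of_liminf_slope_right_lt_deriv_boundary'
    (f := fun y => -j y) (f' := fun x => -(μ / x * j x))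
    (B := fun y => -((y / M) ^ ν * j M)) (B' := fun x => -(ν / x * ((x / M) ^ ν * j M)))
    (a := M) (b := z) hj.continuous.neg.continuousOn ?_ ?_
    (fun x hx => (hderiv x hx.1).continuousAt.continuousWithinAt)
    (fun x hx => (hderiv x hx.1).hasDerivWithinAt) ?_ ⟨hz, le_rfl⟩)
  · intro x hx r hr
    have hx0 : 0 < x := hM.trans_le hx.1
    refine (eventually_slope_neg_lt_of_clarkeDeriv_lt hj hx0 ?_).frequently
    have hmul := mul_lt_mul_of_pos_left hr hx0
    have hcancel : x * -(μ / x * j x) = -(μ * j x) := by field_simp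
    linarith [hsub x hx.1]
  · simp [div_self hM.ne']
  · intro x hx heq
    have hx0 : 0 < x := hM.trans_le hx.1
    have hpos : 0 < (x / M) ^ ν * j M :=
      mul_pos (Real.rpow_pos_of_pos (div_pos hx0 hM) _) hjM
    rw [neg_inj.1 heq]
    gcongr

/-- Pointwise growth estimate from the proof of Lemma 3.3: if `j` is locally Lipschitz,
`j(M) > 0` and `μ·j(z) ≤ -j⁰(z; -z)` for all `z ≥ M`, then
`j(z) ≥ (z/M)^μ · j(M)` for all `z ≥ M`. -/
theorem growth_estimate_lemma_3_3
    (j : ℝ → ℝ) (hj : LocallyLipschitz j)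
    (μ M : ℝ) (hμ : 0 < μ) (hM : 0 < M)
    (hjM : 0 < j M)
    (hsub : ∀ z : ℝ, M ≤ z → μ * j z ≤ -clarkeDeriv j z (-z)) :
    ∀ z : ℝ, M ≤ z → (z / M) ^ μ * j M ≤ j z := by
  intro z hz
  have hbase : z / M ≠ 0 := (div_pos (hM.trans_le hz) hM).ne'
  have hlim : Tendsto (fun ν : ℝ => (z / M) ^ ν * j M) (𝓝[<] μ) (𝓝 ((z / M) ^ μ * j M)) :=
    ((Real.continuousAt_const_rpow hbase).tendsto.mono_left nhdsWithin_le_nhds).mul_const _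
  refine le_of_tendsto hlim ?_
  filter_upwards [self_mem_nhdsWithin] with ν hν
  exact rpow_mul_le_of_lt_exponent hj hν hM hjM hsub hz

end
end
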